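/- arXiv:1202.5715 — 2 statements merged into one kernel-verified Lean document; each statement's English description precedes it below -/
import Mathlib

section
/- Let K ⊆ ℝ² be a compact convex set, and let l, r, t, m ∈ K be points attaining, respectively, the minimum x-coordinate, the maximum x-coordinate, the maximum y-coordinate and the minimum y-coordinate over K; assume l, r, t, m are pairwise distinct, and let C = convexHull ℝ {l, r, t, m} be the core of K. Let p, q ∈ ℝ² with p ∉ interior K, q ∉ interior K, and suppose the closed segment [p, q] is disjoint from the interior of C. Then there exists a continuous path γ : [0,1] → ℝ² with γ(0) = p, γ(1) = q, whose image is contained in [p, q] ∪ frontier K and is disjoint from the interior of K, and whose L1 length (total variation with respect to dist₁) equals dist₁(p, q). (The single-obstacle replacement step in the proof of Lemma 4 of the paper: a segment avoiding the core's interior can be replaced by an obstacle-avoiding path of the same L1 length.) -/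
open scoped ENNReal

noncomputable section

/-- The plane with the `L1` metric. -/
abbrev Plane : Type := WithLp 1 (ℝ × ℝ)

/-- The `x`-coordinate of a point of the `L1` plane. -/
def px (p : Plane) : ℝ := (WithLp.equiv 1 (ℝ × ℝ) p).1

/-- The `y`-coordinate of a point of the `L1` plane. -/
def py (p : Plane) : ℝ := (WithLp.equiv 1 (ℝ × ℝ) p).2

/-- A linear functional takes every intermediate value on a segment inside a convex set. -/
theorem exists_convexCombo_apply_eq {E : Type*} [AddCommGroup E] [Module ℝ E] {K : Set E}
    (hK : Convex ℝ K) (φ : E →ₗ[ℝ] ℝ) {a b : E} (ha : a ∈ K) (hb : b ∈ K) {x : ℝ}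
    (hax : φ a ≤ x) (hxb : x ≤ φ b) :
    ∃ θ : ℝ, 0 ≤ θ ∧ θ ≤ 1 ∧ (1 - θ) • a + θ • b ∈ K ∧ φ ((1 - θ) • a + θ • b) = x := by
  rcases (hax.trans hxb).eq_or_lt with h | h
  · exact ⟨0, le_rfl, zero_le_one, by simpa using ha, by simp; linarith⟩
  · have hd : 0 < φ b - φ a := sub_pos.2 h
    have h0 : 0 ≤ (x - φ a) / (φ b - φ a) := div_nonneg (by linarith) hd.le
    have h1 : (x - φ a) / (φ b - φ a) ≤ 1 := (div_le_one hd).2 (by linarith)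
    refine ⟨_, h0, h1, hK ha hb (by linarith) h0 (by ring), ?_⟩
    simp only [map_add, map_smul, smul_eq_mul]
    field_simp
    ring

section Push

variable {E : Type*} [AddCommGroup E] [Module ℝ E]

/-- The largest amount by which a point of `K` can be moved in direction `w` inside `K`
(and `0` for points outside `K`). -/
def pushHeight (K : Set E) (w z : E) : ℝ :=
  sSup {τ : ℝ | z ∈ K ∧ 0 ≤ τ ∧ z + τ • w ∈ K}

/-- The last point of `K` reached when moving from `z ∈ K` in direction `w`
(and `z` itself for points outside `K`). -/
def push (K : Set E) (w z : E) : E := z + pushHeight K w z • w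

theorem pushHeight_nonneg (K : Set E) (w z : E) : 0 ≤ pushHeight K w z :=
  Real.sSup_nonneg fun _ h => h.2.1

theorem pushHeight_of_notMem {K : Set E} {w z : E} (hz : z ∉ K) : pushHeight K w z = 0 := by
  simp [pushHeight, hz]

theorem push_of_notMem {K : Set E} {w z : E} (hz : z ∉ K) : push K w z = z := by
  simp [push, pushHeight_of_notMem hz]

theorem le_pushHeight {K : Set E} {w z : E} {g : E →ₗ[ℝ] ℝ} {M τ : ℝ} (hw : g w = 1)
    (hM : ∀ e ∈ K, g e ≤ M) (hz : z ∈ K) (hτ : 0 ≤ τ) (h : z + τ • w ∈ K) :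
    τ ≤ pushHeight K w z := by
  refine le_csSup ⟨M - g z, ?_⟩ ⟨hz, hτ, h⟩
  rintro σ ⟨-, -, hσ⟩
  have := hM _ hσ
  simp only [map_add, map_smul, smul_eq_mul, hw] at this
  linarith

theorem push_mem [TopologicalSpace E] [ContinuousAdd E] [ContinuousSMul ℝ E] {K : Set E} {w z : E}
    {g : E →ₗ[ℝ] ℝ} {M : ℝ} (hK : IsClosed K) (hw : g w = 1) (hM : ∀ e ∈ K, g e ≤ M)
    (hz : z ∈ K) : push K w z ∈ K := by
  have hcl : IsClosed {τ : ℝ | z ∈ K ∧ 0 ≤ τ ∧ z + τ • w ∈ K} := by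
    have : IsClosed {τ : ℝ | 0 ≤ τ ∧ z + τ • w ∈ K} :=
      isClosed_Ici.inter (hK.preimage (by fun_prop : Continuous fun τ : ℝ => z + τ • w))
    simpa [hz] using this
  refine (hcl.csSup_mem ⟨0, hz, le_rfl, by simpa using hz⟩ ⟨M - g z, ?_⟩).2.2
  rintro σ ⟨-, -, hσ⟩
  have := hM _ hσ
  simp only [map_add, map_smul, smul_eq_mul, hw] at this
  linarith

/-- From an interior point one can move a little in any direction. -/
theorem exists_pos_add_smul_mem [TopologicalSpace E] [ContinuousAdd E] [ContinuousSMul ℝ E]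
    {K : Set E} {z : E} (w : E) (hz : z ∈ interior K) : ∃ ε : ℝ, 0 < ε ∧ z + ε • w ∈ K := by
  have hc : Continuous fun ε : ℝ => z + ε • w := by fun_prop
  have hev : ∀ᶠ ε : ℝ in nhds 0, z + ε • w ∈ K := by
    refine (hc.tendsto 0).eventually (Filter.mem_of_superset ?_ interior_subset)
    simpa using isOpen_interior.mem_nhds hz
  obtain ⟨ε, hε, hpos⟩ :=
    ((hev.filter_mono nhdsWithin_le_nhds).and (self_mem_nhdsWithin : Set.Ioi (0 : ℝ) ∈ _)).exists
  exact ⟨ε, hpos, hε⟩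

/-- A linear functional is strictly below its maximum at interior points. -/
theorem apply_lt_of_mem_interior [TopologicalSpace E] [ContinuousAdd E] [ContinuousSMul ℝ E]
    {K : Set E} {z w : E} {g : E →ₗ[ℝ] ℝ} {M : ℝ} (hw : g w = 1) (hM : ∀ e ∈ K, g e ≤ M)
    (hz : z ∈ interior K) : g z < M := by
  obtain ⟨ε, hpos, hε⟩ := exists_pos_add_smul_mem w hz
  have := hM _ hε
  simp only [map_add, map_smul, smul_eq_mul, hw] at this
  linarith

theorem push_notMem_interior [TopologicalSpace E] [ContinuousAdd E] [ContinuousSMul ℝ E]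
    {K : Set E} {w z : E} {g : E →ₗ[ℝ] ℝ} {M : ℝ} (hw : g w = 1) (hM : ∀ e ∈ K, g e ≤ M) :
    push K w z ∉ interior K := by
  intro hint
  have hz : z ∈ K := by
    by_contra hz
    rw [push_of_notMem hz] at hint
    exact hz (interior_subset hint)
  obtain ⟨ε, hpos, hε⟩ := exists_pos_add_smul_mem w hint
  have hε' : z + (pushHeight K w z + ε) • w ∈ K := by
    rwa [add_smul, ← add_assoc]
  have := le_pushHeight hw hM hz (by linarith [pushHeight_nonneg K w z]) hε'
  linarith

/-- If `l` minimises `f` over the convex set `K` and lies on the side of the line `A g - B f = c`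
away from `P ∈ K`, the segment between them meets the line at a point of `K` where `f` is
at most its value at `P`. -/
theorem exists_mem_line_apply_le {K : Set E} (hK : Convex ℝ K) {f g : E →ₗ[ℝ] ℝ} {A B c : ℝ}
    {l P : E} (hl : l ∈ K) (hfl : ∀ e ∈ K, f l ≤ f e) (hlc : A * g l - B * f l ≤ c)
    (hP : P ∈ K) (hPc : c ≤ A * g P - B * f P) :
    ∃ e ∈ K, A * g e - B * f e = c ∧ f e ≤ f P := by
  obtain ⟨θ, h0, h1, hmem, heq⟩ := exists_convexCombo_apply_eq hK (A • g - B • f) hl hP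
    (x := c) (by simpa using hlc) (by simpa using hPc)
  refine ⟨_, hmem, by simpa using heq, ?_⟩
  simp only [map_add, map_smul, smul_eq_mul]
  nlinarith [hfl P hP]

theorem push_eq_self {K : Set E} {w z l : E} {f g : E →ₗ[ℝ] ℝ} {A B c : ℝ}
    (hK : Convex ℝ K) (hA : 0 < A) (hB : 0 < B) (hfw : f w = -1) (hgw : g w = 1)
    (hpush : ∀ z ∈ K, push K w z ∈ K)
    (hl : l ∈ K) (hfl : ∀ e ∈ K, f l ≤ f e) (hlc : A * g l - B * f l ≤ c)
    (hzc : A * g z - B * f z = c) (hmin : ∀ e ∈ K, A * g e - B * f e = c → f z ≤ f e) :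
    push K w z = z := by
  by_cases hz : z ∈ K
  · have h0 := pushHeight_nonneg K w z
    have hf : f (push K w z) = f z - pushHeight K w z := by simp [push, hfw]; ring
    have hg : g (push K w z) = g z + pushHeight K w z := by simp [push, hgw]
    obtain ⟨e, he, hec, hle⟩ := exists_mem_line_apply_le hK hl hfl hlc (hpush z hz)
      (by rw [hf, hg]; nlinarith)
    have := hmin e he hec
    have : pushHeight K w z = 0 := by linarith
    simp [push, this]
  · exact push_of_notMem hz

/-- Pushing the points of an increasing line in direction `w` preserves the order of the
`f`-coordinates, provided a minimiser of `f` lies below the line. -/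
theorem apply_push_le_apply_push {K : Set E} {w l z₁ z₂ : E} {f g : E →ₗ[ℝ] ℝ} {A B c : ℝ}
    (hK : Convex ℝ K) (hA : 0 < A) (hB : 0 < B) (hfw : f w = -1) (hgw : g w = 1)
    (hinj : ∀ a b, f a = f b → g a = g b → a = b)
    (hpush : ∀ z ∈ K, push K w z ∈ K)
    (hmax : ∀ z ∈ K, ∀ τ, 0 ≤ τ → z + τ • w ∈ K → τ ≤ pushHeight K w z)
    (hl : l ∈ K) (hfl : ∀ e ∈ K, f l ≤ f e) (hlc : A * g l - B * f l ≤ c)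
    (h₁ : A * g z₁ - B * f z₁ = c) (h₂ : A * g z₂ - B * f z₂ = c) (h₁₂ : f z₁ < f z₂) :
    f (push K w z₁) ≤ f (push K w z₂) := by
  by_contra! hlt
  have hf : ∀ z, f (push K w z) = f z - pushHeight K w z := fun z => by simp [push, hfw]; ring
  have hg : ∀ z, g (push K w z) = g z + pushHeight K w z := fun z => by simp [push, hgw]
  have n₁ := pushHeight_nonneg K w z₁
  have n₂ := pushHeight_nonneg K w z₂
  have hg₁₂ : g z₁ < g z₂ := by nlinarith
  have hz₂ : z₂ ∈ K := by
    by_contra hz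
    have := pushHeight_of_notMem (w := w) hz
    rw [hf, hf] at hlt
    linarith
  have hP := hpush z₂ hz₂
  obtain ⟨e, he, hec, hle⟩ := exists_mem_line_apply_le hK hl hfl hlc hP
    (by rw [hf, hg]; nlinarith)
  have key : ∀ x, f e ≤ x → x ≤ f z₂ → ∃ d ∈ K, A * g d - B * f d = c ∧ f d = x := by
    intro x hx hx'
    obtain ⟨θ, -, -, hmem, heq⟩ := exists_convexCombo_apply_eq hK f he hz₂ hx hx'
    refine ⟨_, hmem, ?_, heq⟩
    simp only [map_add, map_smul, smul_eq_mul]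
    linear_combination (1 - θ) * hec + θ * h₂
  have hz₁ : z₁ ∈ K := by
    obtain ⟨d, hd, hdc, hdf⟩ := key (f z₁) (by linarith [hf z₁]) h₁₂.le
    rwa [hinj z₁ d hdf.symm (mul_left_cancel₀ hA.ne' (by rw [hdf] at hdc; linarith))]
  obtain ⟨d, hd, hdc, hdf⟩ := key (f (push K w z₂)) hle (by linarith [hf z₂])
  have hτ : 0 < f (push K w z₁) - f (push K w z₂) := sub_pos.2 hlt
  set τ := pushHeight K w z₁ + (f (push K w z₁) - f (push K w z₂)) with hτdef
  have hgd : g d ≤ g z₁ + τ := by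
    rw [hf z₁] at hτdef
    have : A * g d ≤ A * g z₁ := by nlinarith
    have := le_of_mul_le_mul_left this hA
    linarith
  obtain ⟨θ, -, -, hmem, heq⟩ := exists_convexCombo_apply_eq hK g hd hP hgd
    (by rw [hg]; rw [hf z₁, hf z₂] at hτdef; linarith)
  have hQ : z₁ + τ • w = (1 - θ) • d + θ • push K w z₂ := by
    refine hinj _ _ ?_ ?_
    · simp only [map_add, map_smul, smul_eq_mul, hfw, hdf]
      rw [hτdef, hf z₁]
      ring
    · rw [heq]
      simp [hgw]
  have := hmax z₁ hz₁ τ (by linarith) (hQ ▸ hmem)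
  linarith

end Push

/-- A constant-speed path from `p` to `q` which runs in `[p, q] ∪ frontier K`, avoids the interior
of `K`, and along which distances are proportional to the time elapsed. -/
def IsReplacementPath (K : Set Plane) (p q : Plane) (γ : ℝ → Plane) : Prop :=
  γ 0 = p ∧ γ 1 = q ∧
    (∀ s ∈ Set.Icc (0 : ℝ) 1, ∀ t ∈ Set.Icc (0 : ℝ) 1, s < t →
      dist (γ s) (γ t) = dist p q * (t - s)) ∧
    ∀ s ∈ Set.Icc (0 : ℝ) 1, γ s ∈ segment ℝ p q ∪ frontier K ∧ γ s ∉ interior K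

/-- A replacement path has the same length as the segment joining its endpoints. -/
theorem IsReplacementPath.exists_path {K : Set Plane} {p q : Plane} {γ : ℝ → Plane}
    (h : IsReplacementPath K p q γ) :
    ∃ γ : ℝ → Plane, ContinuousOn γ (Set.Icc 0 1) ∧ γ 0 = p ∧ γ 1 = q ∧
      γ '' Set.Icc 0 1 ⊆ segment ℝ p q ∪ frontier K ∧
      Disjoint (γ '' Set.Icc 0 1) (interior K) ∧
      eVariationOn γ (Set.Icc 0 1) = edist p q := by
  obtain ⟨h0, h1, hd, himg⟩ := h
  have hlip : LipschitzOnWith (nndist p q) γ (Set.Icc 0 1) := by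
    refine LipschitzOnWith.of_dist_le_mul fun s hs t ht => ?_
    rw [coe_nndist, Real.dist_eq]
    rcases lt_trichotomy s t with hst | rfl | hst
    · rw [hd s hs t ht hst, abs_sub_comm, abs_of_pos (sub_pos.2 hst)]
    · simp
    · rw [dist_comm, hd t ht s hs hst, abs_of_pos (sub_pos.2 hst)]
  refine ⟨γ, hlip.continuousOn, h0, h1, ?_, ?_, le_antisymm ?_ ?_⟩
  · rintro _ ⟨s, hs, rfl⟩
    exact (himg s hs).1
  · rw [Set.disjoint_left]
    rintro _ ⟨s, hs, rfl⟩
    exact (himg s hs).2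
  · have hid : eVariationOn (id : ℝ → ℝ) (Set.Icc 0 1) ≤ 1 := by
      have := (monotone_id.monotoneOn (Set.Icc (0 : ℝ) 1)).eVariationOn_eq
        (Set.left_mem_Icc.2 zero_le_one) (Set.right_mem_Icc.2 zero_le_one)
      rw [Set.inter_self] at this
      simp [this]
    have := hlip.comp_eVariationOn_le (g := (id : ℝ → ℝ)) (s := Set.Icc 0 1) (Set.mapsTo_id _)
    refine this.trans ((mul_le_mul_right hid _).trans ?_)
    rw [mul_one, edist_nndist]
  · have := eVariationOn.edist_le γ (Set.left_mem_Icc.2 (zero_le_one' ℝ))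
      (Set.right_mem_Icc.2 (zero_le_one' ℝ))
    rwa [h0, h1] at this

/-- An increasing segment can be pushed onto the upper left boundary arc of `K` if the leftmost
and topmost points of `K` lie below it. -/
theorem exists_isReplacementPath_of_below {K : Set Plane} (hcl : IsClosed K) (hK : Convex ℝ K)
    {f g : Plane →ₗ[ℝ] ℝ} {w l t p q : Plane} (hfw : f w = -1) (hgw : g w = 1)
    (hinj : ∀ a b, f a = f b → g a = g b → a = b)
    (hdist : ∀ a b, dist a b = |f a - f b| + |g a - g b|)
    (hl : l ∈ K) (ht : t ∈ K) (hfl : ∀ e ∈ K, f l ≤ f e) (hgt : ∀ e ∈ K, g e ≤ g t)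
    (hf : f p < f q) (hg : g p < g q)
    (hlc : (f q - f p) * (g l - g p) ≤ (g q - g p) * (f l - f p))
    (htc : (f q - f p) * (g t - g p) ≤ (g q - g p) * (f t - f p))
    (hline : ∀ e ∈ K, (f q - f p) * (g e - g p) = (g q - g p) * (f e - f p) →
      e ∈ segment ℝ p q) :
    ∃ γ, IsReplacementPath K p q γ := by
  set A := f q - f p with hA'
  set B := g q - g p with hB'
  have hA : 0 < A := sub_pos.2 hf
  have hB : 0 < B := sub_pos.2 hg
  set c := A * g p - B * f p with hc
  have hpush : ∀ z ∈ K, push K w z ∈ K := fun z hz => push_mem hcl hgw hgt hz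
  have hmax : ∀ z ∈ K, ∀ τ, 0 ≤ τ → z + τ • w ∈ K → τ ≤ pushHeight K w z :=
    fun z hz τ hτ h => le_pushHeight hgw hgt hz hτ h
  have hseg : ∀ e ∈ segment ℝ p q, f p ≤ f e ∧ f e ≤ f q ∧ g p ≤ g e ∧ g e ≤ g q := by
    rintro e ⟨a, b, ha, hb, hab, rfl⟩
    obtain rfl : a = 1 - b := by linarith
    simp only [map_add, map_smul, smul_eq_mul]
    refine ⟨?_, ?_, ?_, ?_⟩ <;> nlinarith
  have hline' : ∀ e ∈ K, A * g e - B * f e = c → e ∈ segment ℝ p q :=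
    fun e he hec => hline e he (by linarith)
  have hneg : ∀ e : Plane, B * (-f) e - A * (-g) e = A * g e - B * f e := fun e => by
    simp only [LinearMap.neg_apply]; ring
  set z : ℝ → Plane := fun s => (1 - s) • p + s • q with hz
  have hfz : ∀ s, f (z s) = f p + s * A := fun s => by simp [hz, hA']; ring
  have hgz : ∀ s, g (z s) = g p + s * B := fun s => by simp [hz, hB']; ring
  have hzc : ∀ s, A * g (z s) - B * f (z s) = c := fun s => by rw [hfz, hgz]; ring
  have hnl : ∀ e ∈ K, (-g) t ≤ (-g) e := fun e he => by simpa using hgt e he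
  have htc' : B * (-f) t - A * (-g) t ≤ c := by rw [hneg]; linarith
  have hmonof : ∀ s t, s < t → f (push K w (z s)) ≤ f (push K w (z t)) := fun s t hst =>
    apply_push_le_apply_push hK hA hB hfw hgw hinj hpush hmax hl hfl (by linarith)
      (hzc s) (hzc t) (by rw [hfz, hfz]; nlinarith)
  have hmonog : ∀ s t, s < t → g (push K w (z s)) ≤ g (push K w (z t)) := fun s t' hst => by
    have := apply_push_le_apply_push (f := -g) (g := -f) (z₁ := z t') (z₂ := z s) hK hB hA
      (by simp [hgw]) (by simp [hfw])
      (fun a b h h' => hinj a b (neg_injective h') (neg_injective h)) hpush hmax ht hnl htc'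
      (by rw [hneg, hzc]) (by rw [hneg, hzc])
      (by simp only [LinearMap.neg_apply]; rw [hgz, hgz]; nlinarith)
    simpa using this
  refine ⟨fun s => push K w (z s), ?_, ?_, ?_, ?_⟩
  · have h0 : z 0 = p := by simp [hz]
    simp only [h0]
    exact push_eq_self hK hA hB hfw hgw hpush hl hfl (by linarith) (by rw [hc])
      fun e he hec => (hseg e (hline' e he hec)).1
  · have h1 : z 1 = q := by simp [hz]
    simp only [h1]
    refine push_eq_self (f := -g) (g := -f) hK hB hA (by simp [hgw]) (by simp [hfw]) hpush ht hnl
      htc' (by rw [hneg, ← h1, hzc]) fun e he hec => ?_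
    rw [hneg] at hec
    simpa using (hseg e (hline' e he hec)).2.2.2
  · intro s _ t _ hst
    have hsum : ∀ z, f (push K w z) + g (push K w z) = f z + g z := fun z => by
      simp [push, hfw, hgw]; ring
    have hs := hsum (z s)
    have ht := hsum (z t)
    rw [hfz, hgz] at hs ht
    rw [hdist, hdist, abs_of_nonpos (sub_nonpos.2 (hmonof s t hst)),
      abs_of_nonpos (sub_nonpos.2 (hmonog s t hst)), abs_of_neg (sub_neg.2 hf),
      abs_of_neg (sub_neg.2 hg)]
    linear_combination ht - hs
  · intro s hs
    have hint : push K w (z s) ∉ interior K := push_notMem_interior hgw hgt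
    refine ⟨?_, hint⟩
    by_cases hzK : z s ∈ K
    · exact Or.inr ⟨subset_closure (hpush _ hzK), hint⟩
    · simp only [push_of_notMem hzK]
      exact Or.inl ⟨1 - s, s, by linarith [hs.2], hs.1, by ring, rfl⟩

/-- An increasing segment can be pushed onto the boundary of `K` if the extreme
points of `K` in the coordinate directions lie on one side of it. -/
theorem exists_isReplacementPath_of_lt_of_lt {K S : Set Plane} (hcl : IsClosed K)
    (hK : Convex ℝ K) {f g : Plane →ₗ[ℝ] ℝ} {u v l r t m p q : Plane}
    (hfu : f u = 1) (hgu : g u = 0) (hfv : f v = 0) (hgv : g v = 1)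
    (hdist : ∀ a b, dist a b = |f a - f b| + |g a - g b|) (hSK : S ⊆ K)
    (hl : l ∈ S) (hr : r ∈ S) (ht : t ∈ S) (hm : m ∈ S)
    (hfl : ∀ e ∈ K, f l ≤ f e) (hfr : ∀ e ∈ K, f e ≤ f r)
    (hgt : ∀ e ∈ K, g e ≤ g t) (hgm : ∀ e ∈ K, g m ≤ g e)
    (hf : f p < f q) (hg : g p < g q)
    (hside : (∀ e ∈ S, (f q - f p) * (g e - g p) ≤ (g q - g p) * (f e - f p)) ∨
      (∀ e ∈ S, (g q - g p) * (f e - f p) ≤ (f q - f p) * (g e - g p)))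
    (hline : ∀ e ∈ K, (f q - f p) * (g e - g p) = (g q - g p) * (f e - f p) →
      e ∈ segment ℝ p q) :
    ∃ γ, IsReplacementPath K p q γ := by
  have hinj : ∀ a b, f a = f b → g a = g b → a = b := fun a b h h' =>
    dist_eq_zero.1 (by rw [hdist, h, h']; simp)
  rcases hside with h | h
  · exact exists_isReplacementPath_of_below (w := v - u) hcl hK (by simp [hfu, hfv])
      (by simp [hgu, hgv]) hinj hdist (hSK hl) (hSK ht) hfl hgt hf hg (h l hl) (h t ht) hline
  · exact exists_isReplacementPath_of_below (w := u - v) hcl hK (by simp [hgu, hgv])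
      (by simp [hfu, hfv]) (fun a b h h' => hinj a b h' h) (fun a b => by rw [hdist, add_comm])
      (hSK hm) (hSK hr) hgm hfr hg hf (h m hm) (h r hr) fun e he h => hline e he h.symm

/-- A segment increasing in `f` and not constant in `g` can be pushed onto the boundary of `K`
if the extreme points of `K` in
the coordinate directions lie on one side of it. -/
theorem exists_isReplacementPath_of_lt_of_ne {K S : Set Plane} (hcl : IsClosed K)
    (hK : Convex ℝ K) {f g : Plane →ₗ[ℝ] ℝ} {u v l r t m p q : Plane}
    (hfu : f u = 1) (hgu : g u = 0) (hfv : f v = 0) (hgv : g v = 1)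
    (hdist : ∀ a b, dist a b = |f a - f b| + |g a - g b|) (hSK : S ⊆ K)
    (hl : l ∈ S) (hr : r ∈ S) (ht : t ∈ S) (hm : m ∈ S)
    (hfl : ∀ e ∈ K, f l ≤ f e) (hfr : ∀ e ∈ K, f e ≤ f r)
    (hgt : ∀ e ∈ K, g e ≤ g t) (hgm : ∀ e ∈ K, g m ≤ g e)
    (hf : f p < f q) (hg : g p ≠ g q)
    (hside : (∀ e ∈ S, (f q - f p) * (g e - g p) ≤ (g q - g p) * (f e - f p)) ∨
      (∀ e ∈ S, (g q - g p) * (f e - f p) ≤ (f q - f p) * (g e - g p)))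
    (hline : ∀ e ∈ K, (f q - f p) * (g e - g p) = (g q - g p) * (f e - f p) →
      e ∈ segment ℝ p q) :
    ∃ γ, IsReplacementPath K p q γ := by
  rcases lt_or_gt_of_ne hg with hg | hg
  · exact exists_isReplacementPath_of_lt_of_lt hcl hK hfu hgu hfv hgv hdist hSK hl hr ht hm
      hfl hfr hgt hgm hf hg hside hline
  · refine exists_isReplacementPath_of_lt_of_lt (g := -g) (v := -v) hcl hK hfu (by simp [hgu])
      (by simp [hfv]) (by simp [hgv]) (fun a b => ?_) hSK hl hr hm ht hfl hfr
      (by simpa using hgm) (by simpa using hgt) hf (by simpa using hg)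
      (hside.symm.imp (fun h e he => ?_) fun h e he => ?_) fun e he h => hline e he ?_
    · rw [hdist, abs_sub_comm (g a), LinearMap.neg_apply, LinearMap.neg_apply, neg_sub_neg]
    · simp only [LinearMap.neg_apply]
      linarith [h e he]
    · simp only [LinearMap.neg_apply]
      linarith [h e he]
    · simp only [LinearMap.neg_apply] at h
      linarith

/-- A segment in neither coordinate direction can be pushed onto the boundary of `K` if the extreme
points of `K` in the coordinate directions lie on one side of it. -/
theorem exists_isReplacementPath_of_ne_of_ne {K S : Set Plane} (hcl : IsClosed K)
    (hK : Convex ℝ K) {f g : Plane →ₗ[ℝ] ℝ} {u v l r t m p q : Plane}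
    (hfu : f u = 1) (hgu : g u = 0) (hfv : f v = 0) (hgv : g v = 1)
    (hdist : ∀ a b, dist a b = |f a - f b| + |g a - g b|) (hSK : S ⊆ K)
    (hl : l ∈ S) (hr : r ∈ S) (ht : t ∈ S) (hm : m ∈ S)
    (hfl : ∀ e ∈ K, f l ≤ f e) (hfr : ∀ e ∈ K, f e ≤ f r)
    (hgt : ∀ e ∈ K, g e ≤ g t) (hgm : ∀ e ∈ K, g m ≤ g e)
    (hf : f p ≠ f q) (hg : g p ≠ g q)
    (hside : (∀ e ∈ S, (f q - f p) * (g e - g p) ≤ (g q - g p) * (f e - f p)) ∨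
      (∀ e ∈ S, (g q - g p) * (f e - f p) ≤ (f q - f p) * (g e - g p)))
    (hline : ∀ e ∈ K, (f q - f p) * (g e - g p) = (g q - g p) * (f e - f p) →
      e ∈ segment ℝ p q) :
    ∃ γ, IsReplacementPath K p q γ := by
  rcases lt_or_gt_of_ne hf with hf | hf
  · exact exists_isReplacementPath_of_lt_of_ne hcl hK hfu hgu hfv hgv hdist hSK hl hr ht hm
      hfl hfr hgt hgm hf hg hside hline
  · refine exists_isReplacementPath_of_lt_of_ne (f := -f) (u := -u) hcl hK (by simp [hfu])
      (by simp [hgu]) (by simp [hfv]) hgv (fun a b => ?_) hSK hr hl ht hm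
      (by simpa using hfr) (by simpa using hfl) hgt hgm (by simpa using hf) hg
      (hside.symm.imp (fun h e he => ?_) fun h e he => ?_) fun e he h => hline e he ?_
    · rw [hdist, abs_sub_comm (f a), LinearMap.neg_apply, LinearMap.neg_apply, neg_sub_neg]
    · simp only [LinearMap.neg_apply]
      linarith [h e he]
    · simp only [LinearMap.neg_apply]
      linarith [h e he]
    · simp only [LinearMap.neg_apply] at h
      linarith

/-- The `x`-coordinate as a linear functional. -/
def pxLinear : Plane →ₗ[ℝ] ℝ where
  toFun := px
  map_add' _ _ := rfl
  map_smul' _ _ := rfl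

/-- The `y`-coordinate as a linear functional. -/
def pyLinear : Plane →ₗ[ℝ] ℝ where
  toFun := py
  map_add' _ _ := rfl
  map_smul' _ _ := rfl

/-- The point with given coordinates. -/
def mkPlane (x y : ℝ) : Plane := WithLp.toLp 1 (x, y)

@[simp] theorem pxLinear_apply (e : Plane) : pxLinear e = px e := rfl

@[simp] theorem pyLinear_apply (e : Plane) : pyLinear e = py e := rfl

@[simp] theorem px_mkPlane (x y : ℝ) : px (mkPlane x y) = x := rfl

@[simp] theorem py_mkPlane (x y : ℝ) : py (mkPlane x y) = y := rfl

@[simp] theorem px_add (a b : Plane) : px (a + b) = px a + px b := rfl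

@[simp] theorem py_add (a b : Plane) : py (a + b) = py a + py b := rfl

@[simp] theorem px_smul (c : ℝ) (a : Plane) : px (c • a) = c * px a := rfl

@[simp] theorem py_smul (c : ℝ) (a : Plane) : py (c • a) = c * py a := rfl

theorem plane_ext {a b : Plane} (hx : px a = px b) (hy : py a = py b) : a = b :=
  (WithLp.equiv 1 (ℝ × ℝ)).injective (Prod.ext hx hy)

theorem plane_dist_eq (a b : Plane) : dist a b = |px a - px b| + |py a - py b| :=
  WithLp.prod_dist_eq_of_L1 a b

/-- If distinct points attain the extremes of the coordinates over a set with interior points,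
their convex hull has interior points. -/
theorem interior_core_nonempty {K : Set Plane} {l r t m z : Plane}
    (hl : l ∈ K) (hr : r ∈ K) (ht : t ∈ K)
    (hlmin : ∀ q ∈ K, px l ≤ px q) (hrmax : ∀ q ∈ K, px q ≤ px r)
    (htmax : ∀ q ∈ K, py q ≤ py t) (hmmin : ∀ q ∈ K, py m ≤ py q)
    (hlt : l ≠ t) (hrt : r ≠ t) (hz : z ∈ interior K) :
    (interior (convexHull ℝ {l, r, t, m})).Nonempty := by
  have hlz : -px l > -px z := apply_lt_of_mem_interior (g := -pxLinear) (w := mkPlane (-1) 0)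
    (by simp) (by simpa using hlmin) hz
  have hzr : px z < px r := apply_lt_of_mem_interior (g := pxLinear) (w := mkPlane 1 0)
    (by simp) (by simpa using hrmax) hz
  have hzt : py z < py t := apply_lt_of_mem_interior (g := pyLinear) (w := mkPlane 0 1)
    (by simp) (by simpa using htmax) hz
  have hmz : -py m > -py z := apply_lt_of_mem_interior (g := -pyLinear) (w := mkPlane 0 (-1))
    (by simp) (by simpa using hmmin) hz
  rw [interior_convexHull_nonempty_iff_affineSpan_eq_top]
  by_contra hspan
  have hne : (affineSpan ℝ ({l, r, t, m} : Set Plane) : Set Plane).Nonempty :=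
    ⟨l, subset_affineSpan ℝ _ (by simp)⟩
  have hdir : vectorSpan ℝ ({l, r, t, m} : Set Plane) ≠ ⊤ := by
    rw [← direction_affineSpan]
    exact fun h => hspan ((AffineSubspace.direction_eq_top_iff_of_nonempty hne).1 h)
  obtain ⟨φ, hφ0, hφ⟩ := Submodule.exists_le_ker_of_lt_top _ hdir.lt_top
  obtain ⟨α, β, hφe⟩ : ∃ α β : ℝ, ∀ e : Plane, φ e = α * px e + β * py e := by
    refine ⟨φ (mkPlane 1 0), φ (mkPlane 0 1), fun e => ?_⟩
    have : e = px e • mkPlane 1 0 + py e • mkPlane 0 1 := plane_ext (by simp) (by simp)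
    conv_lhs => rw [this]
    simp only [map_add, map_smul, smul_eq_mul]
    ring
  have heq : ∀ a ∈ ({l, r, t, m} : Set Plane), ∀ b ∈ ({l, r, t, m} : Set Plane),
      φ a = φ b := fun a ha b hb => by
    have := hφ (vsub_mem_vectorSpan ℝ ha hb)
    rw [LinearMap.mem_ker, vsub_eq_sub, map_sub] at this
    linarith
  have hlr := heq l (by simp) r (by simp)
  have htm := heq t (by simp) m (by simp)
  have hlt' := heq l (by simp) t (by simp)
  have hrt' := heq r (by simp) t (by simp)
  rw [hφe, hφe] at hlr htm hlt' hrt'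
  have htl := hlmin t ht
  have htr := hrmax t ht
  have hty := htmax l hl
  have hty' := htmax r hr
  have hβ : β ≠ 0 := by
    intro hβ
    have hα : α = 0 := by
      rw [hβ] at hlr
      have : α * (px l - px r) = 0 := by linarith
      exact (mul_eq_zero.1 this).resolve_right (by linarith)
    exact hφ0 (LinearMap.ext fun e => by rw [hφe]; simp [hα, hβ])
  have hα : α ≠ 0 := by
    intro hα
    rw [hα] at htm
    have : β * (py t - py m) = 0 := by linarith
    exact (mul_ne_zero hβ (by linarith)) this
  -- `t` is the right or the left end of the line through all four points
  have key : px t = px l ∨ px t = px r := by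
    by_contra! h
    have h₁ : px l < px t := lt_of_le_of_ne htl h.1.symm
    have h₂ : px t < px r := lt_of_le_of_ne htr h.2
    have e₁ : α * (px t - px l) = -(β * (py t - py l)) := by linarith
    have e₂ : α * (px r - px t) = β * (py t - py r) := by linarith
    have : α * α * ((px t - px l) * (px r - px t)) =
        -(β * β * ((py t - py l) * (py t - py r))) := by
      linear_combination (α * (px r - px t)) * e₁ - (β * (py t - py l)) * e₂
    have : 0 < α * α * ((px t - px l) * (px r - px t)) :=
      mul_pos (mul_self_pos.2 hα) (mul_pos (by linarith) (by linarith))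
    have : 0 ≤ β * β * ((py t - py l) * (py t - py r)) :=
      mul_nonneg (mul_self_nonneg _) (mul_nonneg (by linarith) (by linarith))
    linarith
  rcases key with h | h
  · exact hlt (plane_ext h.symm (mul_left_cancel₀ hβ (by rw [h] at hlt'; linarith)))
  · exact hrt (plane_ext h.symm (mul_left_cancel₀ hβ (by rw [h] at hrt'; linarith)))

/-- A convex set with interior points lies on one side of a line missing its interior. -/
theorem Convex.forall_le_or_forall_ge_of_interior {C : Set Plane} (hC : Convex ℝ C)
    (hne : (interior C).Nonempty) (φ : Plane →ₗ[ℝ] ℝ) {c : ℝ}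
    (h : ∀ e ∈ interior C, φ e ≠ c) :
    (∀ e ∈ C, φ e ≤ c) ∨ (∀ e ∈ C, c ≤ φ e) := by
  have hφ : Continuous φ := φ.continuous_of_finiteDimensional
  have hsub : C ⊆ closure (interior C) := by
    rw [hC.closure_interior_eq_closure_of_nonempty_interior hne]
    exact subset_closure
  have hint : (∀ e ∈ interior C, φ e ≤ c) ∨ (∀ e ∈ interior C, c ≤ φ e) := by
    by_contra! hcon
    obtain ⟨⟨b, hb, hcb⟩, a, ha, hac⟩ := hcon
    obtain ⟨θ, -, -, hmem, heq⟩ :=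
      exists_convexCombo_apply_eq hC.interior φ ha hb hac.le hcb.le
    exact h _ hmem heq
  exact hint.imp
    (fun h e he => closure_minimal h (isClosed_le hφ continuous_const) (hsub he))
    (fun h e he => closure_minimal h (isClosed_le continuous_const hφ) (hsub he))

/-- The part of `K` on the line through `p` and `q` lies in `[p, q]` if this segment meets the
interior of the convex set `K` but its endpoints do not lie there. -/
theorem mem_segment_of_add_smul_mem {K : Set Plane} (hK : Convex ℝ K) {p q z : Plane}
    (hp : p ∉ interior K) (hq : q ∉ interior K) (hz : z ∈ interior K) (hzs : z ∈ segment ℝ p q)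
    {s : ℝ} (hs : p + s • (q - p) ∈ K) : p + s • (q - p) ∈ segment ℝ p q := by
  rw [segment_eq_image'] at hzs ⊢
  obtain ⟨u, ⟨hu0, hu1⟩, rfl⟩ := hzs
  have hu0' : 0 < u := hu0.lt_of_ne (by rintro rfl; simp at hz; exact hp hz)
  have hu1' : u < 1 := hu1.lt_of_ne (by rintro rfl; simp at hz; exact hq hz)
  have hopen := hK.openSegment_interior_self_subset_interior hz hs
  refine ⟨s, ⟨?_, ?_⟩, rfl⟩
  · by_contra! hs0
    have hd : 0 < u - s := by linarith
    refine hp (hopen ⟨-s / (u - s), u / (u - s), div_pos (by linarith) hd, div_pos hu0' hd,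
      by field_simp; ring, ?_⟩)
    refine plane_ext ?_ ?_ <;>
    · simp only [px_add, py_add, px_smul, py_smul]
      field_simp
      ring
  · by_contra! hs1
    have hd : 0 < s - u := by linarith
    refine hq (hopen ⟨(s - 1) / (s - u), (1 - u) / (s - u), div_pos (by linarith) hd,
      div_pos (by linarith) hd, by field_simp; ring, ?_⟩)
    have e : q = p + (q - p) := by abel
    generalize q - p = v at e
    subst e
    refine plane_ext ?_ ?_ <;>
    · simp only [px_add, py_add, px_smul, py_smul]
      field_simp
      ring

theorem exists_eq_add_smul_of_mem_line {p q e : Plane} (hpq : p ≠ q)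
    (h : (px q - px p) * (py e - py p) = (py q - py p) * (px e - px p)) :
    ∃ s : ℝ, e = p + s • (q - p) := by
  have hx : ∀ s, px (p + s • (q - p)) = px p + s * (px q - px p) := fun _ => rfl
  have hy : ∀ s, py (p + s • (q - p)) = py p + s * (py q - py p) := fun _ => rfl
  by_cases h0 : px q - px p = 0
  · have h1 : py q - py p ≠ 0 := fun h1 => hpq (plane_ext (by linarith) (by linarith))
    have h2 : px e - px p = 0 := by
      rw [h0, zero_mul, eq_comm] at h
      exact (mul_eq_zero.1 h).resolve_left h1
    refine ⟨(py e - py p) / (py q - py p), plane_ext ?_ ?_⟩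
    · rw [hx, h0]
      linarith
    · rw [hy]
      field_simp
      ring
  · refine ⟨(px e - px p) / (px q - px p), plane_ext ?_ ?_⟩
    · rw [hx]
      field_simp
      ring
    · rw [hy]
      field_simp
      linarith

/-- Single-obstacle replacement step: if a segment `[p,q]` with endpoints outside
the interior of a compact convex obstacle `K` avoids the interior of the core of
`K`, then there is a continuous path from `p` to `q`, contained in
`[p,q] ∪ frontier K` and avoiding the interior of `K`, whose `L1` length equals
the `L1` distance between `p` and `q`. -/
theorem segment_avoiding_core_replaceable (K : Set Plane) (hKc : IsCompact K)
    (hKconv : Convex ℝ K) (l r t m : Plane)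
    (hl : l ∈ K) (hr : r ∈ K) (ht : t ∈ K) (hm : m ∈ K)
    (hlmin : ∀ q ∈ K, px l ≤ px q) (hrmax : ∀ q ∈ K, px q ≤ px r)
    (htmax : ∀ q ∈ K, py q ≤ py t) (hmmin : ∀ q ∈ K, py m ≤ py q)
    (hne : l ≠ r ∧ l ≠ t ∧ l ≠ m ∧ r ≠ t ∧ r ≠ m ∧ t ≠ m)
    (p q : Plane) (hp : p ∉ interior K) (hq : q ∉ interior K)
    (hseg : Disjoint (segment ℝ p q) (interior (convexHull ℝ {l, r, t, m}))) :
    ∃ γ : ℝ → Plane, ContinuousOn γ (Set.Icc 0 1) ∧ γ 0 = p ∧ γ 1 = q ∧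
      γ '' Set.Icc 0 1 ⊆ segment ℝ p q ∪ frontier K ∧
      Disjoint (γ '' Set.Icc 0 1) (interior K) ∧
      eVariationOn γ (Set.Icc 0 1) = edist p q := by
  suffices ∃ γ, IsReplacementPath K p q γ from this.elim fun _ h => h.exists_path
  by_cases hmeet : Disjoint (segment ℝ p q) (interior K)
  · refine ⟨AffineMap.lineMap p q, by simp, by simp, fun s _ t _ hst => ?_, fun s hs => ?_⟩
    · rw [dist_lineMap_lineMap, Real.dist_eq, abs_sub_comm, abs_of_pos (sub_pos.2 hst), mul_comm]
    · have hmem : AffineMap.lineMap p q s ∈ segment ℝ p q := by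
        rw [segment_eq_image_lineMap]
        exact Set.mem_image_of_mem _ hs
      exact ⟨Or.inl hmem, Set.disjoint_left.1 hmeet hmem⟩
  obtain ⟨z, hzs, hz⟩ := Set.not_disjoint_iff.1 hmeet
  have hpq : p ≠ q := by
    rintro rfl
    rw [segment_same, Set.mem_singleton_iff] at hzs
    exact hp (hzs ▸ hz)
  have hcoreK : convexHull ℝ {l, r, t, m} ⊆ K := by
    refine convexHull_min ?_ hKconv
    rintro e (rfl | rfl | rfl | rfl) <;> assumption
  have hline : ∀ e ∈ K, (px q - px p) * (py e - py p) = (py q - py p) * (px e - px p) →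
      e ∈ segment ℝ p q := by
    intro e he h
    obtain ⟨s, rfl⟩ := exists_eq_add_smul_of_mem_line hpq h
    exact mem_segment_of_add_smul_mem hKconv hp hq hz hzs he
  have hside := (convex_convexHull ℝ ({l, r, t, m} : Set Plane)).forall_le_or_forall_ge_of_interior
    (interior_core_nonempty hl hr ht hlmin hrmax htmax hmmin hne.2.1 hne.2.2.2.1 hz)
    ((px q - px p) • pyLinear - (py q - py p) • pxLinear)
    (c := (px q - px p) * py p - (py q - py p) * px p) (by
      intro e he h
      simp only [LinearMap.sub_apply, LinearMap.smul_apply, pxLinear_apply, pyLinear_apply,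
        smul_eq_mul] at h
      exact Set.disjoint_left.1 hseg
        (hline e (hcoreK (interior_subset he)) (by linarith)) he)
  replace hside : (∀ e ∈ ({l, r, t, m} : Set Plane),
        (px q - px p) * (py e - py p) ≤ (py q - py p) * (px e - px p)) ∨
      (∀ e ∈ ({l, r, t, m} : Set Plane),
        (py q - py p) * (px e - px p) ≤ (px q - px p) * (py e - py p)) := by
    refine hside.imp (fun h e he => ?_) (fun h e he => ?_) <;>
    · have := h e (subset_convexHull ℝ _ he)
      simp only [LinearMap.sub_apply, LinearMap.smul_apply, pxLinear_apply, pyLinear_apply,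
        smul_eq_mul] at this
      linarith
  have hlz : -px z < -px l := apply_lt_of_mem_interior (g := -pxLinear) (w := mkPlane (-1) 0)
    (by simp) (by simpa using hlmin) hz
  have hzr : px z < px r := apply_lt_of_mem_interior (g := pxLinear) (w := mkPlane 1 0)
    (by simp) (by simpa using hrmax) hz
  have hzt : py z < py t := apply_lt_of_mem_interior (g := pyLinear) (w := mkPlane 0 1)
    (by simp) (by simpa using htmax) hz
  have hmz : -py z < -py m := apply_lt_of_mem_interior (g := -pyLinear) (w := mkPlane 0 (-1))
    (by simp) (by simpa using hmmin) hz
  have hzline : (px q - px p) * (py z - py p) = (py q - py p) * (px z - px p) := by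
    obtain ⟨a, b, -, -, hab, rfl⟩ := hzs
    obtain rfl : a = 1 - b := by linarith
    simp only [px_add, py_add, px_smul, py_smul]
    ring
  have hside' : (∀ e ∈ ({l, r, t, m} : Set Plane),
        (px q - px p) * (py e - py z) ≤ (py q - py p) * (px e - px z)) ∨
      (∀ e ∈ ({l, r, t, m} : Set Plane),
        (py q - py p) * (px e - px z) ≤ (px q - px p) * (py e - py z)) := by
    refine hside.imp (fun h e he => ?_) (fun h e he => ?_) <;> linarith [h e he]
  have hx : px p ≠ px q := by
    intro h
    have hy : py q - py p ≠ 0 := fun h' => hpq (plane_ext h (by linarith))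
    rw [← h, sub_self] at hside'
    rcases hside' with h | h <;>
    · have h₁ := h l (by simp)
      have h₂ := h r (by simp)
      rcases lt_or_gt_of_ne hy with hy | hy <;> nlinarith
  have hy : py p ≠ py q := by
    intro h
    have hx' : px q - px p ≠ 0 := sub_ne_zero.2 hx.symm
    rw [← h, sub_self] at hside'
    rcases hside' with h | h <;>
    · have h₁ := h t (by simp)
      have h₂ := h m (by simp)
      rcases lt_or_gt_of_ne hx' with hx' | hx' <;> nlinarith
  exact exists_isReplacementPath_of_ne_of_ne (f := pxLinear) (g := pyLinear) (u := mkPlane 1 0)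
    (v := mkPlane 0 1) hKc.isClosed hKconv (by simp) (by simp) (by simp) (by simp) plane_dist_eq
    ((subset_convexHull ℝ _).trans hcoreK) (by simp) (by simp) (by simp) (by simp)
    hlmin hrmax htmax hmmin hx hy hside hline
end
end

section
/- Let (p₁, w₁) and (p₂, w₂) be weighted sites in the L1 plane, and let B = {q : w₁ + dist₁(q, p₁) = w₂ + dist₁(q, p₂)} be their weighted L1 bisector. For all q, q' ∈ ℝ² with q.y = q'.y, q.x ≥ max(p₁.x, p₂.x) and q'.x ≥ max(p₁.x, p₂.x), one has q ∈ B if and only if q' ∈ B. In words: in the region to the right of both sites, membership in the weighted L1 bisector depends only on the y-coordinate, so the bisector there is a union of horizontal half-lines going east. (The horizontal half-line claim of Observation 2 of the paper.) -/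
open scoped ENNReal

noncomputable section

/-- The `L1` distance as a sum of coordinate distances. -/
theorem dist_eq_abs_px_add_abs_py (p q : Plane) :
    dist p q = |px p - px q| + |py p - py q| := by
  simp [WithLp.prod_dist_eq_add (p := 1) (by norm_num), px, py, Real.dist_eq]

/-- To the right of both sites, membership in the weighted `L1` bisector depends
only on the `y`-coordinate: the bisector there is a union of horizontal
half-lines going east. -/
theorem weighted_bisector_horizontal_halflines (p₁ p₂ : Plane) (w₁ w₂ : ℝ) :
    ∀ q q' : Plane, py q = py q' →
      max (px p₁) (px p₂) ≤ px q → max (px p₁) (px p₂) ≤ px q' →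
      (w₁ + dist q p₁ = w₂ + dist q p₂ ↔ w₁ + dist q' p₁ = w₂ + dist q' p₂) := by
  intro q q' hy hq hq'
  obtain ⟨h₁, h₂⟩ := max_le_iff.mp hq
  obtain ⟨h₁', h₂'⟩ := max_le_iff.mp hq'
  simp only [dist_eq_abs_px_add_abs_py, hy, abs_of_nonneg (sub_nonneg.mpr h₁),
    abs_of_nonneg (sub_nonneg.mpr h₂), abs_of_nonneg (sub_nonneg.mpr h₁'),
    abs_of_nonneg (sub_nonneg.mpr h₂')]
  constructor <;> intro h <;> linarith
end
end
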